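/- Let 1 < p ≤ q < ∞ and let ω, ν ∈ D be radial weights with ω̂, ν̂ > 0 on [0,1). Then there exists C > 0 such that every analytic function f on 𝔻 with ∥f∥_{B_{dγ}} = sup_{z∈𝔻} |f'(z)|(1−|z|)γ(z) + |f(0)| < ∞ belongs to A^q_ν and satisfies ∥f∥_{A^q_ν} ≤ C ∥f∥_{B_{dγ}}. -/

import Mathlib

open MeasureTheory Set
open scoped ENNReal ComplexConjugate

noncomputable section

/-- The open unit disc in `ℂ`. -/
def UD : Set ℂ := Metric.ball (0 : ℂ) 1

/-- Normalized area measure `dA = dx dy / π` on `ℂ`. -/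
def dA : Measure ℂ := (ENNReal.ofReal Real.pi)⁻¹ • (MeasureTheory.volume : Measure ℂ)

/-- `ω̂(r) = ∫_r^1 ω(s) ds` for a (radial) weight `ω : ℂ → ℝ`. -/
def what (ω : ℂ → ℝ) (r : ℝ) : ℝ := ∫ s in r..(1 : ℝ), ω (s : ℂ)

/-- A radial weight: nonnegative, radial, integrable over the unit disc. -/
def RadialWeight (ω : ℂ → ℝ) : Prop :=
  (∀ z, 0 ≤ ω z) ∧ (∀ z : ℂ, ω z = ω ((‖z‖ : ℝ) : ℂ)) ∧ IntegrableOn ω UD dA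

/-- `ω̂ > 0` on `[0,1)`. -/
def WhatPos (ω : ℂ → ℝ) : Prop := ∀ r : ℝ, 0 ≤ r → r < 1 → 0 < what ω r

/-- The class `D̂`. -/
def Dhat (ω : ℂ → ℝ) : Prop :=
  ∃ C > (1 : ℝ), ∀ r : ℝ, 0 ≤ r → r < 1 → what ω r ≤ C * what ω ((1 + r) / 2)

/-- The class `Ď`. -/
def Dcheck (ω : ℂ → ℝ) : Prop :=
  ∃ K > (1 : ℝ), ∃ C > (1 : ℝ), ∀ r : ℝ, 0 ≤ r → r < 1 →
    C * what ω (1 - (1 - r) / K) ≤ what ω r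

/-- The class `D = D̂ ∩ Ď`. -/
def Dclass (ω : ℂ → ℝ) : Prop := Dhat ω ∧ Dcheck ω

/-- A `Ď`-exponent `α > 0` for `ω`: `ω̂(t) ≤ C ((1-t)/(1-r))^α ω̂(r)` for `0 ≤ r ≤ t < 1`. -/
def DcheckExp (ω : ℂ → ℝ) (α : ℝ) : Prop :=
  ∃ C > (0 : ℝ), ∀ r t : ℝ, 0 ≤ r → r ≤ t → t < 1 →
    what ω t ≤ C * ((1 - t) / (1 - r)) ^ α * what ω r

/-- A `D̂`-exponent `β > 0` for `ω`: `ω̂(r) ≤ C ((1-r)/(1-t))^β ω̂(t)` for `0 ≤ r ≤ t < 1`. -/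
def DhatExp (ω : ℂ → ℝ) (β : ℝ) : Prop :=
  ∃ C > (0 : ℝ), ∀ r t : ℝ, 0 ≤ r → r ≤ t → t < 1 →
    what ω r ≤ C * ((1 - r) / (1 - t)) ^ β * what ω t

/-- Weighted `L^p` "norm" over the unit disc. -/
def wnorm (p : ℝ) (ω : ℂ → ℝ) (f : ℂ → ℂ) : ℝ :=
  (∫ z in UD, ‖f z‖ ^ p * ω z ∂dA) ^ (1 / p)

/-- Membership in the weighted Lebesgue space `L^p_ω`. -/
def MemLw (p : ℝ) (ω : ℂ → ℝ) (f : ℂ → ℂ) : Prop :=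
  AEStronglyMeasurable f (dA.restrict UD) ∧
  IntegrableOn (fun z => ‖f z‖ ^ p * ω z) UD dA

/-- Membership in the weighted Bergman space `A^p_ω`. -/
def MemAp (p : ℝ) (ω : ℂ → ℝ) (f : ℂ → ℂ) : Prop :=
  DifferentiableOn ℂ f UD ∧ IntegrableOn (fun z => ‖f z‖ ^ p * ω z) UD dA

/-- `H^∞`: bounded analytic functions on the unit disc. -/
def Hinfty (f : ℂ → ℂ) : Prop :=
  DifferentiableOn ℂ f UD ∧ ∃ M : ℝ, ∀ z ∈ UD, ‖f z‖ ≤ M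

/-- Moments `ν_x = ∫_0^1 t^x ν(t) dt`. -/
def mom (ν : ℂ → ℝ) (x : ℝ) : ℝ := ∫ t in (0 : ℝ)..1, t ^ x * ν (t : ℂ)

/-- The Bergman reproducing kernel of `A²_ν`. -/
def Bker (ν : ℂ → ℝ) (z ζ : ℂ) : ℂ :=
  ∑' n : ℕ, (ζ * conj z) ^ n / (((2 * mom ν (2 * (n : ℝ) + 1) : ℝ)) : ℂ)

/-- The Bergman projection `P_ν`. -/
def Pw (ν : ℂ → ℝ) (f : ℂ → ℂ) (z : ℂ) : ℂ :=
  ∫ ζ in UD, f ζ * conj (Bker ν z ζ) * ((ν ζ : ℝ) : ℂ) ∂dA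

/-- The Hankel operator `H_f^ν(g) = f g − P_ν(f g)`. -/
def Hankel (ν : ℂ → ℝ) (f g : ℂ → ℂ) (z : ℂ) : ℂ :=
  f z * g z - Pw ν (fun ζ => f ζ * g ζ) z

/-- The standard weighted Bergman projection `P_η`. -/
def Pstd (η : ℝ) (f : ℂ → ℂ) (z : ℂ) : ℂ :=
  (((η + 1 : ℝ)) : ℂ) *
    ∫ ζ in UD, f ζ * (((1 - ‖ζ‖ ^ 2) ^ η : ℝ) : ℂ) *
      (1 - z * conj ζ) ^ (((-(2 + η) : ℝ)) : ℂ) ∂dA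

/-- The Bekollé–Bonami class `B_q` (for radial weights). -/
def Bq (q : ℝ) (ν : ℂ → ℝ) : Prop :=
  ∃ η > (-1 : ℝ), ∃ C > (0 : ℝ), ∀ f : ℂ → ℂ, MemLw q ν f →
    wnorm q ν (Pstd η f) ≤ C * wnorm q ν f

/-- Pseudo-hyperbolic distance. -/
def pd (z ζ : ℂ) : ℝ := ‖(z - ζ) / (1 - conj z * ζ)‖

/-- Hyperbolic distance `β(z,ζ)`. -/
def hyp (z ζ : ℂ) : ℝ := (1 / 2) * Real.log ((1 + pd z ζ) / (1 - pd z ζ))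

/-- The hyperbolic disc `Δ(z,r)`. -/
def hDisc (z : ℂ) (r : ℝ) : Set ℂ := {ζ ∈ UD | hyp z ζ < r}

/-- `ν(Δ(z,r))`. -/
def nuD (ν : ℂ → ℝ) (z : ℂ) (r : ℝ) : ℝ := ∫ ζ in hDisc z r, ν ζ ∂dA

/-- The function `γ(z)`. -/
def gam (ω ν : ℂ → ℝ) (p q : ℝ) (z : ℂ) : ℝ :=
  (what ν ‖z‖) ^ (1 / q) * (1 - ‖z‖) ^ (1 / q) /
    ((what ω ‖z‖) ^ (1 / p) * (1 - ‖z‖) ^ (1 / p))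

/-- The average `f̂_{r,ν}(z)`. -/
def havg (ν : ℂ → ℝ) (r : ℝ) (f : ℂ → ℂ) (z : ℂ) : ℂ :=
  (∫ ζ in hDisc z r, ν ζ • f ζ ∂dA) / ((nuD ν z r : ℝ) : ℂ)

/-- The mean oscillation `MO_{ν,q,r}(f)(z)`. -/
def MO (ν : ℂ → ℝ) (q r : ℝ) (f : ℂ → ℂ) (z : ℂ) : ℝ :=
  ((∫ ζ in hDisc z r, ‖f ζ - havg ν r f z‖ ^ q * ν ζ ∂dA) / nuD ν z r) ^ (1 / q)

/-- Finiteness of the `BMO(Δ)_{ω,ν,p,q,r}` norm. -/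
def BMOfin (ω ν : ℂ → ℝ) (p q r : ℝ) (f : ℂ → ℂ) : Prop :=
  ∃ M : ℝ, ∀ z ∈ UD, MO ν q r f z * gam ω ν p q z ≤ M

/-- Boundedness of the Hankel operator `H_f^ν : A^p_ω → L^q_ν` tested on `H^∞`. -/
def HankelBdd (p q : ℝ) (ω ν : ℂ → ℝ) (f : ℂ → ℂ) : Prop :=
  ∃ C > (0 : ℝ), ∀ g : ℂ → ℂ, Hinfty g → wnorm q ν (Hankel ν f g) ≤ C * wnorm p ω g

/-- `ω̂` extended by the convention `ω̂(t) = ω̂(0)` for `t < 0`. -/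
def whatE (ω : ℂ → ℝ) (t : ℝ) : ℝ := what ω (max t 0)

/-- The function `Γ_τ(z,ζ)`. -/
def Gam (ω ν : ℂ → ℝ) (p q τ : ℝ) (z ζ : ℂ) : ℝ :=
  ((‖1 - conj z * ζ‖ ^ 2 / max (1 - ‖z‖ ^ 2) (1 - ‖ζ‖ ^ 2)) ^ (1 / p - (τ + 1) / q) *
      whatE ω (1 - 2 * ‖1 - conj z * ζ‖ ^ 2 / max (1 - ‖z‖ ^ 2) (1 - ‖ζ‖ ^ 2)) ^ (1 / p)) /
    (min (what ν ‖z‖ / (1 - ‖z‖) ^ τ) (what ν ‖ζ‖ / (1 - ‖ζ‖) ^ τ)) ^ (1 / q)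

/-- The generalized Berezin transform `B_{ν,c,σ}(φ)(z)` of a real-valued `φ`. -/
def Ber (ν : ℂ → ℝ) (c σ : ℝ) (φ : ℂ → ℝ) (z : ℂ) : ℝ :=
  (1 - ‖z‖ ^ 2) ^ (c + 1) / what ν ‖z‖ *
    ∫ ζ in UD, φ ζ * (1 - ‖ζ‖ ^ 2) ^ σ * ‖1 - z * conj ζ‖ ^ (-(2 + c + σ)) * ν ζ ∂dA

/-- The operator `T_{b,c}`. -/
def Tbc (b c : ℝ) (f : ℂ → ℂ) (z : ℂ) : ℂ :=
  ∫ ζ in UD, f ζ * (((1 - ‖ζ‖ ^ 2) ^ b : ℝ) : ℂ) * (1 - z * conj ζ) ^ (((-c : ℝ)) : ℂ) ∂dA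

/-- The operator `S_{b,c}`. -/
def Sbc (b c : ℝ) (f : ℂ → ℂ) (z : ℂ) : ℂ :=
  ∫ ζ in UD, f ζ * ((((1 - ‖ζ‖ ^ 2) ^ b * ‖1 - z * conj ζ‖ ^ (-c)) : ℝ) : ℂ) ∂dA

/-- The standard kernel `B^η_z(ζ) = (1 − conj(z) ζ)^{−(2+η)}`. -/
def Bstd (η : ℝ) (z ζ : ℂ) : ℂ := (1 - conj z * ζ) ^ (((-(2 + η) : ℝ)) : ℂ)

/-- The normalized kernel `b^η_{z,ω}`. -/
def bnrm (p : ℝ) (ω : ℂ → ℝ) (η : ℝ) (z ζ : ℂ) : ℂ :=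
  Bstd η z ζ / ((wnorm p ω (Bstd η z) : ℝ) : ℂ)

/-- The function `g^η_{z,ω} = P_ν(conj(f) b^η_{z,ω}) / b^η_{z,ω}`. -/
def gfn (ν : ℂ → ℝ) (p : ℝ) (ω : ℂ → ℝ) (η : ℝ) (f : ℂ → ℂ) (z ζ : ℂ) : ℂ :=
  Pw ν (fun u => conj (f u) * bnrm p ω η z u) ζ / bnrm p ω η z ζ

end

lemma lintegral_UD_comp_norm_le (g : ℝ → ℝ≥0∞) :
    ∫⁻ z in UD, g ‖z‖ ∂dA ≤
      (ENNReal.ofReal Real.pi)⁻¹ * (ENNReal.ofReal (2 * Real.pi) * ∫⁻ r in Ioo 0 1, g r) := by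
  have hUD : MeasurableSet UD := Metric.isOpen_ball.measurableSet
  rw [dA, Measure.restrict_smul, lintegral_smul_measure, smul_eq_mul]
  gcongr
  rw [← lintegral_indicator hUD, ← Complex.lintegral_comp_polarCoord_symm]
  have htarget : polarCoord.target = Ioi (0 : ℝ) ×ˢ Ioo (-Real.pi) Real.pi := rfl
  rw [htarget, Measure.volume_eq_prod, ← Measure.prod_restrict]
  refine (lintegral_prod_le _).trans ?_
  calc ∫⁻ r in Ioi (0 : ℝ), ∫⁻ θ in Ioo (-Real.pi) Real.pi,
        ENNReal.ofReal r • UD.indicator (fun z => g ‖z‖) (Complex.polarCoord.symm (r, θ))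
      ≤ ∫⁻ r in Ioi (0 : ℝ), ∫⁻ θ in Ioo (-Real.pi) Real.pi, (Ioo (0 : ℝ) 1).indicator g r := by
        refine setLIntegral_mono' measurableSet_Ioi fun r hr => lintegral_mono fun θ => ?_
        have hr0 : (0 : ℝ) < r := hr
        have hn : ‖Complex.polarCoord.symm (r, θ)‖ = r := by
          rw [Complex.norm_polarCoord_symm, abs_of_pos hr0]
        by_cases h : r < 1
        · have h1 : Complex.polarCoord.symm (r, θ) ∈ UD := by
            rw [UD, mem_ball_zero_iff, hn]; exact h
          have h2 : r ∈ Ioo (0 : ℝ) 1 := ⟨hr0, h⟩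
          rw [indicator_of_mem h1, indicator_of_mem h2, hn, smul_eq_mul]
          refine mul_le_of_le_one_left' ?_
          rw [← ENNReal.ofReal_one]
          exact ENNReal.ofReal_le_ofReal h.le
        · have h1 : Complex.polarCoord.symm (r, θ) ∉ UD := by
            rw [UD, mem_ball_zero_iff, hn]; exact h
          rw [indicator_of_notMem h1]
          simp
    _ = ∫⁻ r in Ioi (0 : ℝ), ENNReal.ofReal (2 * Real.pi) * (Ioo (0 : ℝ) 1).indicator g r := by
        congr 1 with r
        rw [setLIntegral_const, Real.volume_Ioo, mul_comm]
        ring_nf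
    _ = ENNReal.ofReal (2 * Real.pi) * ∫⁻ r in Ioo 0 1, g r := by
        rw [lintegral_const_mul' _ _ ENNReal.ofReal_ne_top, setLIntegral_indicator measurableSet_Ioo,
          inter_eq_left.mpr Ioo_subset_Ioi_self]

lemma lintegral_mul_lintegral_div_tail_le {n k : ℝ → ℝ≥0∞}
    (hn : AEMeasurable n (volume.restrict (Ioo 0 1))) (hk : Measurable k) :
    ∫⁻ r in Ioo (0 : ℝ) 1, n r * ∫⁻ t in Ioo 0 r, k t / ∫⁻ s in Ioo t 1, n s ≤
      ∫⁻ t in Ioo (0 : ℝ) 1, k t := by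
  set U : ℝ → ℝ≥0∞ := fun t => ∫⁻ s in Ioo t 1, n s
  have hU : Measurable U := by
    refine Antitone.measurable fun a b hab => ?_
    exact lintegral_mono_set (Ioo_subset_Ioo_left hab)
  have hV : Measurable fun t => k t / U t := hk.div hU
  calc ∫⁻ r in Ioo (0 : ℝ) 1, n r * ∫⁻ t in Ioo 0 r, k t / U t
      = ∫⁻ r in Ioo (0 : ℝ) 1, ∫⁻ t in Ioo (0 : ℝ) 1,
          n r * {x : ℝ × ℝ | x.2 < x.1}.indicator (fun x => k x.2 / U x.2) (r, t) := by
        refine setLIntegral_congr_fun measurableSet_Ioo fun r hr => ?_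
        have hm : Measurable fun t : ℝ =>
            {x : ℝ × ℝ | x.2 < x.1}.indicator (fun x => k x.2 / U x.2) (r, t) :=
          ((hV.comp measurable_snd).indicator
            (measurableSet_lt measurable_snd measurable_fst)).comp measurable_prodMk_left
        rw [lintegral_const_mul _ hm]
        congr 1
        have : ∀ t, {x : ℝ × ℝ | x.2 < x.1}.indicator (fun x => k x.2 / U x.2) (r, t) =
            (Iio r).indicator (fun t => k t / U t) t := fun t => by
          simp [indicator_apply]
        simp_rw [this]
        rw [setLIntegral_indicator measurableSet_Iio]
        congr 2
        ext t
        simp only [mem_inter_iff, mem_Iio, mem_Ioo]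
        constructor
        · exact fun h => ⟨h.2, h.1, h.2.trans hr.2⟩
        · exact fun h => ⟨h.2.1, h.1⟩
    _ = ∫⁻ t in Ioo (0 : ℝ) 1, ∫⁻ r in Ioo (0 : ℝ) 1,
          n r * {x : ℝ × ℝ | x.2 < x.1}.indicator (fun x => k x.2 / U x.2) (r, t) := by
        refine lintegral_lintegral_swap ?_
        exact hn.comp_fst.mul ((hV.comp measurable_snd).indicator
          (measurableSet_lt measurable_snd measurable_fst)).aemeasurable
    _ ≤ ∫⁻ t in Ioo (0 : ℝ) 1, k t := by
        refine setLIntegral_mono' measurableSet_Ioo fun t ht => ?_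
        have : ∀ r, n r * {x : ℝ × ℝ | x.2 < x.1}.indicator (fun x => k x.2 / U x.2) (r, t) =
            (Ioi t).indicator n r * (k t / U t) := fun r => by
          by_cases h : t < r <;> simp [h]
        simp_rw [this]
        rw [lintegral_mul_const'' _ (hn.indicator measurableSet_Ioi),
          setLIntegral_indicator measurableSet_Ioi]
        have hset : Ioi t ∩ Ioo 0 1 = Ioo t 1 := by
          ext r
          simp only [mem_inter_iff, mem_Ioi, mem_Ioo]
          exact ⟨fun h => ⟨h.1, h.2.2⟩, fun h => ⟨h.1, ht.1.trans h.1, h.2⟩⟩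
        rw [hset]
        exact ENNReal.mul_div_le

lemma lintegral_mul_rpow_neg_rpow_le {α : Type*} [MeasurableSpace α] {μ : Measure α}
    {k U : α → ℝ≥0∞} (hk : AEMeasurable k μ) (hU : AEMeasurable U μ) {q : ℝ} (hq : 1 ≤ q) :
    (∫⁻ x, k x * U x ^ (-(1 / q)) ∂μ) ^ q ≤
      (∫⁻ x, k x ∂μ) ^ (q - 1) * ∫⁻ x, k x / U x ∂μ := by
  have hq0 : 0 < q := by linarith
  have h1q : 1 / q ≤ 1 := (div_le_one hq0).mpr hq
  have key : ∫⁻ x, k x * U x ^ (-(1 / q)) ∂μ ≤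
      (∫⁻ x, k x ∂μ) ^ (1 - 1 / q) * (∫⁻ x, k x / U x ∂μ) ^ (1 / q) := by
    refine le_trans (lintegral_mono fun x => ?_) (ENNReal.lintegral_mul_norm_pow_le hk
      (hk.div hU) (by linarith) (by positivity) (by ring))
    rw [Pi.div_apply, div_eq_mul_inv (k x), ENNReal.mul_rpow_of_nonneg _ _ (by positivity : 0 ≤ 1 / q),
      ← mul_assoc, ENNReal.inv_rpow, ← ENNReal.rpow_neg,
      ← ENNReal.rpow_add_of_nonneg _ _ (by linarith) (by positivity)]
    simp
  calc _ ≤ ((∫⁻ x, k x ∂μ) ^ (1 - 1 / q) * (∫⁻ x, k x / U x ∂μ) ^ (1 / q)) ^ q := by gcongr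
    _ = _ := by
      rw [ENNReal.mul_rpow_of_nonneg _ _ hq0.le, ← ENNReal.rpow_mul, ← ENNReal.rpow_mul,
        one_div_mul_cancel hq0.ne', ENNReal.rpow_one]
      congr 2
      field_simp

lemma WhatPos.intervalIntegrable {ω : ℂ → ℝ} (h : WhatPos ω) :
    IntervalIntegrable (fun s : ℝ => ω s) volume 0 1 := by
  by_contra hn
  exact (h 0 le_rfl one_pos).ne' (intervalIntegral.integral_undef hn)

lemma what_anti {ω : ℂ → ℝ} (h0 : ∀ z, 0 ≤ ω z) (h : WhatPos ω) {r t : ℝ} (hr : 0 ≤ r)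
    (hrt : r ≤ t) (ht : t ≤ 1) : what ω t ≤ what ω r :=
  intervalIntegral.integral_mono_interval hrt ht le_rfl (.of_forall fun s => h0 _)
    (h.intervalIntegrable.mono_set (by
      rw [uIcc_of_le (hrt.trans ht), uIcc_of_le zero_le_one]; exact Icc_subset_Icc_left hr))

lemma lintegral_Ioo_eq_ofReal_what {ω : ℂ → ℝ} (h0 : ∀ z, 0 ≤ ω z) (h : WhatPos ω) {t : ℝ}
    (ht : 0 ≤ t) (ht1 : t ≤ 1) :
    ∫⁻ s in Ioo t 1, ENNReal.ofReal (ω s) = ENNReal.ofReal (what ω t) := by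
  have hi : IntegrableOn (fun s : ℝ => ω s) (Ioc t 1) :=
    ((intervalIntegrable_iff_integrableOn_Ioc_of_le zero_le_one).mp
      h.intervalIntegrable).mono_set (Ioc_subset_Ioc_left ht)
  rw [what, intervalIntegral.integral_of_le ht1,
    ofReal_integral_eq_lintegral_ofReal hi (.of_forall fun s => h0 _), restrict_Ioo_eq_restrict_Ioc]

lemma Dcheck.exists_what_le_rpow {ω : ℂ → ℝ} (hD : Dcheck ω) (h0 : ∀ z, 0 ≤ ω z)
    (h : WhatPos ω) :
    ∃ α > (0 : ℝ), ∃ A > (0 : ℝ), ∀ t, 0 ≤ t → t < 1 → what ω t ≤ A * (1 - t) ^ α := by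
  obtain ⟨K, hK, C, hC, hKC⟩ := hD
  have hK0 : 0 < K := one_pos.trans hK
  have hC0 : 0 < C := one_pos.trans hC
  have hlK : 0 < Real.log K := Real.log_pos hK
  set α := Real.log C / Real.log K with hα
  have hCK : C = K ^ α := by
    rw [Real.rpow_def_of_pos hK0, hα, mul_div_cancel₀ _ hlK.ne', Real.exp_log hC0]
  have hα0 : 0 < α := div_pos (Real.log_pos hC) hlK
  have hw0 := h 0 le_rfl one_pos
  have hiter : ∀ n : ℕ, C ^ n * what ω (1 - (K ^ n)⁻¹) ≤ what ω 0 := by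
    intro n
    induction n with
    | zero => simp
    | succ n ih =>
      have hp : 1 ≤ K ^ n := one_le_pow₀ hK.le
      have h1 : (K ^ n)⁻¹ ≤ 1 := inv_le_one_of_one_le₀ hp
      have h2 : 0 < (K ^ n)⁻¹ := by positivity
      have := hKC (1 - (K ^ n)⁻¹) (by linarith) (by linarith)
      have heq : 1 - (1 - (1 - (K ^ n)⁻¹)) / K = 1 - (K ^ (n + 1))⁻¹ := by
        rw [pow_succ]; field_simp; ring
      rw [heq] at this
      calc C ^ (n + 1) * what ω (1 - (K ^ (n + 1))⁻¹)
          = C ^ n * (C * what ω (1 - (K ^ (n + 1))⁻¹)) := by ring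
        _ ≤ C ^ n * what ω (1 - (K ^ n)⁻¹) := by gcongr
        _ ≤ _ := ih
  refine ⟨α, hα0, what ω 0 * K ^ α, by positivity, fun t ht ht1 => ?_⟩
  have ht' : 0 < 1 - t := by linarith
  obtain ⟨n, hn1, hn2⟩ := exists_nat_pow_near (one_le_inv_iff₀.mpr ⟨ht', by linarith⟩) hK
  have hKn : 0 < K ^ n := by positivity
  have h1 : 1 - t ≤ (K ^ n)⁻¹ := (le_inv_comm₀ hKn ht').mp hn1
  have h2 : 0 ≤ 1 - (K ^ n)⁻¹ := by
    have := inv_le_one_of_one_le₀ (one_le_pow₀ hK.le : 1 ≤ K ^ n)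
    linarith
  have h3 : (K ^ n)⁻¹ ≤ K * (1 - t) := by
    rw [inv_lt_comm₀ ht' (by positivity), pow_succ, mul_inv] at hn2
    rw [inv_le_iff_one_le_mul₀ hKn]
    have := (mul_lt_mul_of_pos_left hn2 (mul_pos hKn hK0)).le
    have e : K ^ n * K * ((K ^ n)⁻¹ * K⁻¹) = 1 := by field_simp
    rw [e] at this
    linarith
  have hpow : ((K ^ n)⁻¹) ^ α = (C ^ n)⁻¹ := by
    rw [Real.inv_rpow hKn.le, ← Real.rpow_pow_comm hK0.le, ← hCK]
  calc what ω t ≤ what ω (1 - (K ^ n)⁻¹) := what_anti h0 h h2 (by linarith) ht1.le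
    _ ≤ what ω 0 * ((K ^ n)⁻¹) ^ α := by
      rw [hpow, ← div_eq_mul_inv, le_div_iff₀ (by positivity), mul_comm]
      exact hiter n
    _ ≤ what ω 0 * (K * (1 - t)) ^ α := by gcongr
    _ = what ω 0 * K ^ α * (1 - t) ^ α := by rw [Real.mul_rpow hK0.le ht'.le, mul_assoc]

lemma lintegral_const_mul_one_sub_rpow_lt_top (B : ℝ) {ε : ℝ} (hε : 0 < ε) :
    ∫⁻ t in Ioo (0 : ℝ) 1, ENNReal.ofReal (B * (1 - t) ^ (ε - 1)) < ∞ := by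
  have h : IntervalIntegrable (fun t : ℝ => B * (1 - t) ^ (ε - 1)) volume 0 1 := by
    have := (intervalIntegral.intervalIntegrable_rpow' (a := 1) (b := 0)
      (by linarith : -1 < ε - 1)).comp_sub_left 1
    simp only [sub_self, sub_zero] at this
    exact this.const_mul B
  rw [intervalIntegrable_iff_integrableOn_Ioo_of_le zero_le_one] at h
  exact (lintegral_mono fun t => Real.ofReal_le_enorm _).trans_lt h.2

lemma enorm_le_add_lintegral_of_enorm_deriv_le {f : ℂ → ℂ} (hf : DifferentiableOn ℂ f UD)
    {h : ℝ → ℝ≥0∞} (hd : ∀ z ∈ UD, ‖deriv f z‖ₑ ≤ h ‖z‖) {z : ℂ} (hz : z ∈ UD) :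
    ‖f z‖ₑ ≤ ‖f 0‖ₑ + ∫⁻ t in Ioo 0 ‖z‖, h t := by
  obtain ⟨e, he, hze⟩ : ∃ e : ℂ, ‖e‖ = 1 ∧ z = ‖z‖ * e := by
    rcases eq_or_ne z 0 with rfl | h0
    · exact ⟨1, by simp, by simp⟩
    · have : (‖z‖ : ℂ) ≠ 0 := by simpa using h0
      exact ⟨z / ‖z‖, by simp [h0], by field_simp⟩
  have hz1 : ‖z‖ < 1 := by simpa [UD] using hz
  have hopen : IsOpen UD := Metric.isOpen_ball
  have hmem : ∀ t ∈ Icc (0 : ℝ) ‖z‖, (t : ℂ) * e ∈ UD := fun t ht => by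
    rw [UD, mem_ball_zero_iff, norm_mul, he, mul_one, Complex.norm_real, Real.norm_of_nonneg ht.1]
    exact ht.2.trans_lt hz1
  have hderiv : ∀ t ∈ uIcc (0 : ℝ) ‖z‖,
      HasDerivAt (fun t : ℝ => f (t * e)) (deriv f (t * e) * e) t := fun t ht => by
    rw [uIcc_of_le (norm_nonneg z)] at ht
    have h1 := ((hf.differentiableAt (hopen.mem_nhds (hmem t ht))).hasDerivAt)
    have h2 : HasDerivAt (fun t : ℝ => (t : ℂ) * e) e t := by
      simpa using (Complex.ofRealCLM.hasDerivAt (x := t)).mul_const e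
    exact h1.comp t h2
  have hcont : ContinuousOn (fun t : ℝ => deriv f (t * e) * e) (uIcc 0 ‖z‖) := by
    rw [uIcc_of_le (norm_nonneg z)]
    refine ContinuousOn.mul ?_ continuousOn_const
    exact (hf.deriv hopen).continuousOn.comp (by fun_prop) hmem
  have hint := intervalIntegral.integral_eq_sub_of_hasDerivAt hderiv hcont.intervalIntegrable
  rw [← hze, Complex.ofReal_zero, zero_mul, intervalIntegral.integral_of_le (norm_nonneg z)] at hint
  calc ‖f z‖ₑ = ‖f 0 + (f z - f 0)‖ₑ := by ring_nf
    _ ≤ ‖f 0‖ₑ + ‖f z - f 0‖ₑ := enorm_add_le _ _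
    _ ≤ ‖f 0‖ₑ + ∫⁻ t in Ioc 0 ‖z‖, ‖deriv f (t * e) * e‖ₑ := by
      rw [← hint]; gcongr; exact enorm_integral_le_lintegral_enorm _
    _ ≤ ‖f 0‖ₑ + ∫⁻ t in Ioo 0 ‖z‖, h t := by
      rw [← restrict_Ioo_eq_restrict_Ioc]
      refine add_le_add le_rfl ?_
      refine setLIntegral_mono' measurableSet_Ioo fun t ht => ?_
      have hm := hmem t (Ioo_subset_Icc_self ht)
      have he' : ‖e‖ₑ = 1 := by rw [← ofReal_norm, he, ENNReal.ofReal_one]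
      rw [enorm_mul, he', mul_one]
      refine (hd _ hm).trans_eq ?_
      rw [norm_mul, he, mul_one, Complex.norm_real, Real.norm_of_nonneg ht.1.le]

lemma lintegral_one_add_lintegral_rpow_mul_lt_top {n k : ℝ → ℝ≥0∞}
    (hn : AEMeasurable n (volume.restrict (Ioo 0 1))) (hk : Measurable k)
    (hnt : ∫⁻ r in Ioo (0 : ℝ) 1, n r < ∞) (hkt : ∫⁻ r in Ioo (0 : ℝ) 1, k r < ∞)
    {q : ℝ} (hq : 1 ≤ q) :
    ∫⁻ r in Ioo (0 : ℝ) 1,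
      (1 + ∫⁻ t in Ioo 0 r, k t * (∫⁻ s in Ioo t 1, n s) ^ (-(1 / q))) ^ q * n r < ∞ := by
  set U : ℝ → ℝ≥0∞ := fun t => ∫⁻ s in Ioo t 1, n s
  have hU : Measurable U :=
    Antitone.measurable fun a b hab => lintegral_mono_set (Ioo_subset_Ioo_left hab)
  set κ := ∫⁻ r in Ioo (0 : ℝ) 1, k r
  have hq1 : 0 ≤ q - 1 := by linarith
  have hκq : κ ^ (q - 1) ≠ ∞ := ENNReal.rpow_ne_top_of_nonneg hq1 hkt.ne
  have h2q : (2 : ℝ≥0∞) ^ (q - 1) ≠ ∞ := ENNReal.rpow_ne_top_of_nonneg hq1 (by simp)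
  calc ∫⁻ r in Ioo (0 : ℝ) 1, (1 + ∫⁻ t in Ioo 0 r, k t * U t ^ (-(1 / q))) ^ q * n r
      ≤ ∫⁻ r in Ioo (0 : ℝ) 1,
          2 ^ (q - 1) * (n r + κ ^ (q - 1) * (n r * ∫⁻ t in Ioo 0 r, k t / U t)) := by
        refine setLIntegral_mono' measurableSet_Ioo fun r hr => ?_
        have h1 : (∫⁻ t in Ioo 0 r, k t * U t ^ (-(1 / q))) ^ q ≤
            κ ^ (q - 1) * ∫⁻ t in Ioo 0 r, k t / U t := by
          refine (lintegral_mul_rpow_neg_rpow_le hk.aemeasurable hU.aemeasurable hq).trans ?_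
          gcongr
          exact lintegral_mono_set (Ioo_subset_Ioo_right hr.2.le)
        calc _ ≤ 2 ^ (q - 1) * (1 ^ q + (∫⁻ t in Ioo 0 r, k t * U t ^ (-(1 / q))) ^ q) * n r := by
              gcongr
              exact ENNReal.rpow_add_le_mul_rpow_add_rpow _ _ hq
          _ ≤ 2 ^ (q - 1) * (1 + κ ^ (q - 1) * ∫⁻ t in Ioo 0 r, k t / U t) * n r := by
              rw [ENNReal.one_rpow]
              gcongr
          _ = _ := by ring
    _ = 2 ^ (q - 1) * ((∫⁻ r in Ioo (0 : ℝ) 1, n r) +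
          κ ^ (q - 1) * ∫⁻ r in Ioo (0 : ℝ) 1, n r * ∫⁻ t in Ioo 0 r, k t / U t) := by
        rw [lintegral_const_mul' _ _ h2q, lintegral_add_left' hn, lintegral_const_mul' _ _ hκq]
    _ ≤ 2 ^ (q - 1) * ((∫⁻ r in Ioo (0 : ℝ) 1, n r) + κ ^ (q - 1) * κ) := by
        gcongr
        exact lintegral_mul_lintegral_div_tail_le hn hk
    _ < ∞ := ENNReal.mul_lt_top h2q.lt_top
        (ENNReal.add_lt_top.mpr ⟨hnt, ENNReal.mul_lt_top hκq.lt_top hkt⟩)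

lemma exists_le_of_mul_gam_le {ω ν : ℂ → ℝ} {p q : ℝ} (hp : 0 < p) (hpq : p ≤ q)
    (h0 : ∀ z, 0 ≤ ω z) (hωp : WhatPos ω) (hωD : Dcheck ω) (hνp : WhatPos ν) :
    ∃ ε > (0 : ℝ), ∃ B > (0 : ℝ), ∀ z ∈ UD, ∀ x N : ℝ, 0 ≤ N →
      x * (1 - ‖z‖) * gam ω ν p q z ≤ N →
        x ≤ N * (B * (1 - ‖z‖) ^ (ε - 1) * what ν ‖z‖ ^ (-(1 / q))) := by
  obtain ⟨α, hα, A, hA, hw⟩ := hωD.exists_what_le_rpow h0 hωp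
  have hq : 0 < q := hp.trans_le hpq
  refine ⟨α / p, by positivity, A ^ (1 / p), by positivity, fun z hz x N hN hx => ?_⟩
  have hz1 : ‖z‖ < 1 := by simpa [UD] using hz
  have hz0 := norm_nonneg z
  have hwz := hw _ hz0 hz1
  have hwpos := hωp _ hz0 hz1
  have hupos := hνp _ hz0 hz1
  rw [gam] at hx
  set w := what ω ‖z‖
  set u := what ν ‖z‖
  obtain ⟨d, hd⟩ : ∃ d, d = 1 - ‖z‖ := ⟨_, rfl⟩
  rw [← hd] at hx hwz ⊢
  have hd0 : 0 < d := by linarith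
  have hd1 : d ≤ 1 := by linarith
  have hdd : d ^ (1 / p) ≤ d ^ (1 / q) :=
    Real.rpow_le_rpow_of_exponent_ge hd0 hd1 (one_div_le_one_div_of_le hp hpq)
  have hwA : w ^ (1 / p) ≤ A ^ (1 / p) * d ^ (α / p) := by
    calc w ^ (1 / p) ≤ (A * d ^ α) ^ (1 / p) := by gcongr
      _ = _ := by
        rw [Real.mul_rpow hA.le (by positivity), ← Real.rpow_mul hd0.le, mul_one_div]
  have hU : 0 < u ^ (1 / q) := by positivity
  have hW : 0 < w ^ (1 / p) := by positivity
  have hQ : 0 < d ^ (1 / q) := by positivity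
  have hP : 0 < d ^ (1 / p) := by positivity
  have hx' : x * (d * u ^ (1 / q) * d ^ (1 / q)) ≤ N * (w ^ (1 / p) * d ^ (1 / p)) := by
    rw [← mul_div_assoc, div_le_iff₀ (by positivity)] at hx
    linarith
  have hx'' : x * (d * u ^ (1 / q)) ≤ N * (A ^ (1 / p) * d ^ (α / p)) := by
    refine le_of_mul_le_mul_right ?_ hQ
    calc x * (d * u ^ (1 / q)) * d ^ (1 / q) ≤ N * (w ^ (1 / p) * d ^ (1 / p)) := by linarith
      _ ≤ N * (A ^ (1 / p) * d ^ (α / p) * d ^ (1 / q)) := by gcongr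
      _ = _ := by ring
  rw [Real.rpow_sub_one hd0.ne', Real.rpow_neg hupos.le]
  calc x = x * (d * u ^ (1 / q)) / (d * u ^ (1 / q)) := by field_simp
    _ ≤ N * (A ^ (1 / p) * d ^ (α / p)) / (d * u ^ (1 / q)) := by gcongr
    _ = _ := by field_simp

/-- embedding in the proof of Theorem 1.2: `B_{dγ} ⊂ A^q_ν` with
`‖f‖_{A^q_ν} ≤ C ‖f‖_{B_{dγ}}`. -/
theorem bloch_embeds_in_Aq (p q : ℝ) (hp : 1 < p) (hpq : p ≤ q)
    (ω ν : ℂ → ℝ) (hω : RadialWeight ω) (hωp : WhatPos ω) (hωD : Dclass ω)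
    (hν : RadialWeight ν) (hνp : WhatPos ν) (hνD : Dclass ν) :
    ∃ C > (0 : ℝ), ∀ f : ℂ → ℂ, DifferentiableOn ℂ f UD →
      BddAbove ((fun z => ‖deriv f z‖ * (1 - ‖z‖) * gam ω ν p q z) '' UD) →
      MemLw q ν f ∧
      wnorm q ν f ≤
        C * (sSup ((fun z => ‖deriv f z‖ * (1 - ‖z‖) * gam ω ν p q z) '' UD) + ‖f 0‖) := by
  obtain ⟨hω0, -, -⟩ := hω
  obtain ⟨hν0, hνr, hνi⟩ := hν
  have hq1 : 1 ≤ q := hp.le.trans hpq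
  have hq0 : 0 < q := by linarith
  obtain ⟨ε, hε, B, hB, hbound⟩ :=
    exists_le_of_mul_gam_le (ν := ν) (by linarith : 0 < p) hpq hω0 hωp hωD.2 hνp
  set n : ℝ → ℝ≥0∞ := fun s => ENNReal.ofReal (ν s) with hn
  set k : ℝ → ℝ≥0∞ := fun t => ENNReal.ofReal (B * (1 - t) ^ (ε - 1)) with hk
  set U : ℝ → ℝ≥0∞ := fun t => ∫⁻ s in Ioo t 1, n s with hU
  set Ψ : ℝ → ℝ≥0∞ := fun r => ∫⁻ t in Ioo 0 r, k t * U t ^ (-(1 / q)) with hΨ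
  have hnm : AEMeasurable n (volume.restrict (Ioo 0 1)) :=
    ((intervalIntegrable_iff_integrableOn_Ioo_of_le zero_le_one).mp
      hνp.intervalIntegrable).aestronglyMeasurable.aemeasurable.ennreal_ofReal
  have hnt : ∫⁻ s in Ioo (0 : ℝ) 1, n s < ∞ := by
    rw [hn, lintegral_Ioo_eq_ofReal_what hν0 hνp le_rfl zero_le_one]
    exact ENNReal.ofReal_lt_top
  have hkm : Measurable k := by fun_prop
  set D : ℝ≥0∞ := ∫⁻ z in UD, (1 + Ψ ‖z‖) ^ q * n ‖z‖ ∂dA with hD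
  have hDt : D < ∞ := by
    refine (lintegral_UD_comp_norm_le fun r => (1 + Ψ r) ^ q * n r).trans_lt ?_
    refine ENNReal.mul_lt_top ?_ (ENNReal.mul_lt_top ENNReal.ofReal_lt_top ?_)
    · simp [Real.pi_pos]
    · exact lintegral_one_add_lintegral_rpow_mul_lt_top hnm hkm hnt
        (lintegral_const_mul_one_sub_rpow_lt_top B hε) hq1
  refine ⟨D.toReal ^ (1 / q) + 1, by positivity, fun f hf hbdd => ?_⟩
  set N := sSup ((fun z => ‖deriv f z‖ * (1 - ‖z‖) * gam ω ν p q z) '' UD)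
  have hle : ∀ z ∈ UD, ‖deriv f z‖ * (1 - ‖z‖) * gam ω ν p q z ≤ N := fun z hz =>
    le_csSup hbdd (mem_image_of_mem _ hz)
  have hN : 0 ≤ N := by
    refine le_trans ?_ (hle 0 (by simp [UD]))
    have h1 := hωp 0 le_rfl one_pos
    have h2 := hνp 0 le_rfl one_pos
    rw [gam, norm_zero]
    positivity
  set S := N + ‖f 0‖
  have hS0 : 0 ≤ S := by positivity
  have hd : ∀ z ∈ UD, ‖deriv f z‖ₑ ≤ ENNReal.ofReal N * (k ‖z‖ * U ‖z‖ ^ (-(1 / q))) := by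
    intro z hz
    have hz1 : ‖z‖ < 1 := by simpa [UD] using hz
    have hu := hνp _ (norm_nonneg z) hz1
    have hB' : 0 ≤ B * (1 - ‖z‖) ^ (ε - 1) :=
      mul_nonneg hB.le (Real.rpow_nonneg (by linarith) _)
    rw [hU, hn, hk]
    dsimp only
    rw [lintegral_Ioo_eq_ofReal_what hν0 hνp (norm_nonneg z) hz1.le,
      ENNReal.ofReal_rpow_of_pos hu, ← ENNReal.ofReal_mul hB', ← ENNReal.ofReal_mul hN,
      ← ofReal_norm]
    exact ENNReal.ofReal_le_ofReal (hbound z hz _ N hN (hle z hz))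
  have hfz : ∀ z ∈ UD, ‖f z‖ₑ ≤ ENNReal.ofReal S * (1 + Ψ ‖z‖) := by
    intro z hz
    refine (enorm_le_add_lintegral_of_enorm_deriv_le hf
      (h := fun t => ENNReal.ofReal N * (k t * U t ^ (-(1 / q)))) hd hz).trans ?_
    rw [lintegral_const_mul' _ _ ENNReal.ofReal_ne_top, mul_add, mul_one, ← ofReal_norm]
    gcongr
    · exact le_add_of_nonneg_left hN
    · exact le_add_of_nonneg_right (norm_nonneg _)
  have hUDm : MeasurableSet UD := Metric.isOpen_ball.measurableSet
  have hfm : AEStronglyMeasurable f (dA.restrict UD) :=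
    hf.continuousOn.aestronglyMeasurable hUDm
  have hgm : AEStronglyMeasurable (fun z => ‖f z‖ ^ q * ν z) (dA.restrict UD) :=
    (hfm.norm.aemeasurable.pow_const q).aestronglyMeasurable.mul hνi.aestronglyMeasurable
  have hg0 : ∀ z, 0 ≤ ‖f z‖ ^ q * ν z := fun z =>
    mul_nonneg (Real.rpow_nonneg (norm_nonneg _) _) (hν0 z)
  have hint : ∫⁻ z in UD, ENNReal.ofReal (‖f z‖ ^ q * ν z) ∂dA ≤ ENNReal.ofReal S ^ q * D := by
    rw [hD, ← lintegral_const_mul' _ _ (ENNReal.rpow_ne_top_of_nonneg hq0.le ENNReal.ofReal_ne_top)]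
    refine setLIntegral_mono' hUDm fun z hz => ?_
    rw [ENNReal.ofReal_mul (Real.rpow_nonneg (norm_nonneg _) _),
      ← ENNReal.ofReal_rpow_of_nonneg (norm_nonneg _) hq0.le, ofReal_norm, hνr z, ← mul_assoc,
      ← ENNReal.mul_rpow_of_nonneg _ _ hq0.le]
    gcongr
    exact hfz z hz
  have hSD : ENNReal.ofReal S ^ q * D ≠ ∞ :=
    ENNReal.mul_ne_top (ENNReal.rpow_ne_top_of_nonneg hq0.le ENNReal.ofReal_ne_top) hDt.ne
  refine ⟨⟨hfm, hgm, ?_⟩, ?_⟩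
  · rw [hasFiniteIntegral_iff_ofReal (.of_forall hg0)]
    exact hint.trans_lt hSD.lt_top
  · rw [wnorm, integral_eq_lintegral_of_nonneg_ae (.of_forall hg0) hgm]
    have h1 := ENNReal.toReal_mono hSD hint
    rw [ENNReal.toReal_mul, ← ENNReal.toReal_rpow, ENNReal.toReal_ofReal hS0] at h1
    calc _ ≤ (S ^ q * D.toReal) ^ (1 / q) := by gcongr
      _ = D.toReal ^ (1 / q) * S := by
        rw [Real.mul_rpow (by positivity) (by positivity), ← Real.rpow_mul hS0,
          mul_one_div_cancel hq0.ne', Real.rpow_one, mul_comm]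
      _ ≤ _ := by gcongr; linarith
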